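/- The space V_ρ(λ;p) is complete with respect to the Luxemburg norm: if (x^n) is a sequence in V_ρ(λ;p) such that ‖x^n − x^m‖_L → 0 as m, n → ∞, then there exists x ∈ V_ρ(λ;p) with ‖x^n − x‖_L → 0 as n → ∞. -/

import Mathlib

open Filter
open scoped BigOperators ENNReal

/-- The index window `I_k = {j ∈ ℤ : k - λ_k + 1 ≤ j ≤ k}` of the
de la Vallée-Poussin mean (indices are positive integers). -/
noncomputable def vpWindow (lam : ℕ → ℝ) (k : ℕ) : Finset ℕ :=
  (Finset.Icc 1 k).filter fun j => (k : ℝ) - lam k + 1 ≤ (j : ℝ)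

/-- The modular `ρ(x) = ∑_{k≥1} ((1/λ_k) ∑_{j ∈ I_k} |x_j|)^{p_k}`,
valued in `ℝ≥0∞` (so that `ρ(x) < ∞` is meaningful). -/
noncomputable def vpModular (lam pp : ℕ → ℝ) (x : ℕ → ℝ) : ℝ≥0∞ :=
  ∑' k : ℕ, ENNReal.ofReal
    (((lam (k + 1))⁻¹ * ∑ j ∈ vpWindow lam (k + 1), |x j|) ^ pp (k + 1))

/-- Membership in `V_ρ(λ;p) = {x : ρ(t x) < ∞ for some t > 0}`. -/
def memVrho (lam pp : ℕ → ℝ) (x : ℕ → ℝ) : Prop :=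
  ∃ t : ℝ, 0 < t ∧ vpModular lam pp (t • x) < ⊤

/-- The Luxemburg norm `‖x‖_L = inf {t > 0 : ρ(x/t) ≤ 1}`. -/
noncomputable def luxNorm (lam pp : ℕ → ℝ) (x : ℕ → ℝ) : ℝ :=
  sInf {t : ℝ | 0 < t ∧ vpModular lam pp (t⁻¹ • x) ≤ 1}

/-- The weighted window mean `(1/λ_k) ∑_{j ∈ I_k} |x_j|`. -/
noncomputable def vpMean (lam : ℕ → ℝ) (x : ℕ → ℝ) (k : ℕ) : ℝ :=
  (lam k)⁻¹ * ∑ j ∈ vpWindow lam k, |x j|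

lemma vpModular_eq_tsum_vpMean (lam pp x : ℕ → ℝ) :
    vpModular lam pp x = ∑' k : ℕ, ENNReal.ofReal (vpMean lam x (k + 1) ^ pp (k + 1)) := rfl

lemma vpMean_nonneg {lam : ℕ → ℝ} {k : ℕ} (hk : 0 < lam k) (x : ℕ → ℝ) :
    0 ≤ vpMean lam x k :=
  mul_nonneg (inv_nonneg.2 hk.le) (Finset.sum_nonneg fun _ _ => abs_nonneg _)

lemma vpMean_smul (lam x : ℕ → ℝ) {c : ℝ} (hc : 0 ≤ c) (k : ℕ) :
    vpMean lam (c • x) k = c * vpMean lam x k := by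
  simp only [vpMean, Pi.smul_apply, smul_eq_mul, abs_mul, abs_of_nonneg hc, ← Finset.mul_sum]
  ring

lemma vpMean_sub_le {lam : ℕ → ℝ} {k : ℕ} (hk : 0 < lam k) (x y : ℕ → ℝ) :
    vpMean lam (x - y) k ≤ vpMean lam x k + vpMean lam y k := by
  simp only [vpMean, ← mul_add, ← Finset.sum_add_distrib]
  refine mul_le_mul_of_nonneg_left (Finset.sum_le_sum fun j _ => ?_) (inv_nonneg.2 hk.le)
  exact abs_sub (x j) (y j)

lemma tendsto_vpMean (lam : ℕ → ℝ) {u : ℕ → ℕ → ℝ} {x : ℕ → ℝ} {k : ℕ}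
    (h : ∀ j, 1 ≤ j → Tendsto (fun m => u m j) atTop (nhds (x j))) :
    Tendsto (fun m => vpMean lam (u m) k) atTop (nhds (vpMean lam x k)) := by
  refine Tendsto.const_mul _ (tendsto_finsetSum _ fun j hj => (h j ?_).abs)
  exact (Finset.mem_Icc.1 (Finset.mem_filter.1 hj).1).1

lemma abs_le_mul_vpMean {lam : ℕ → ℝ} {j : ℕ} (hj : 1 ≤ j) (hlam : 1 ≤ lam j) (x : ℕ → ℝ) :
    |x j| ≤ lam j * vpMean lam x j := by
  rw [vpMean, mul_inv_cancel_left₀ (by linarith)]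
  refine Finset.single_le_sum (f := fun i => |x i|) (fun _ _ => abs_nonneg _) ?_
  simp only [vpWindow, Finset.mem_filter, Finset.mem_Icc]
  exact ⟨⟨hj, le_rfl⟩, by linarith⟩

section Modular

variable {lam pp : ℕ → ℝ}

lemma vpModular_smul_le (hlam : ∀ k, 1 ≤ k → 0 < lam k) (hp : ∀ k, 1 ≤ k → 1 < pp k)
    (x : ℕ → ℝ) {c : ℝ} (hc : 0 ≤ c) (hc1 : c ≤ 1) :
    vpModular lam pp (c • x) ≤ ENNReal.ofReal c * vpModular lam pp x := by
  simp only [vpModular_eq_tsum_vpMean, ← ENNReal.tsum_mul_left]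
  refine ENNReal.tsum_le_tsum fun k => ?_
  have hm := vpMean_nonneg (hlam (k + 1) (by omega)) x
  have hpk := hp (k + 1) (by omega)
  rw [← ENNReal.ofReal_mul hc, vpMean_smul _ _ hc, Real.mul_rpow hc hm]
  refine ENNReal.ofReal_le_ofReal (mul_le_mul_of_nonneg_right ?_ (Real.rpow_nonneg hm _))
  simpa using Real.rpow_le_rpow_of_exponent_ge' hc hc1 zero_le_one hpk.le

lemma vpModular_smul_le_self (hlam : ∀ k, 1 ≤ k → 0 < lam k) (hp : ∀ k, 1 ≤ k → 1 < pp k)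
    (x : ℕ → ℝ) {c : ℝ} (hc : 0 ≤ c) (hc1 : c ≤ 1) :
    vpModular lam pp (c • x) ≤ vpModular lam pp x :=
  (vpModular_smul_le hlam hp x hc hc1).trans
    (mul_le_of_le_one_left' (ENNReal.ofReal_le_one.2 hc1))

lemma vpModular_sub_le (hlam : ∀ k, 1 ≤ k → 0 < lam k) (hp : ∀ k, 1 ≤ k → 1 < pp k)
    (x y : ℕ → ℝ) :
    vpModular lam pp (x - y)
      ≤ vpModular lam pp ((2 : ℝ) • x) + vpModular lam pp ((2 : ℝ) • y) := by
  simp only [vpModular_eq_tsum_vpMean, ← ENNReal.tsum_add]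
  refine ENNReal.tsum_le_tsum fun k => ?_
  have hk := hlam (k + 1) (by omega)
  have hpk : 0 ≤ pp (k + 1) := by linarith [hp (k + 1) (by omega)]
  have hd := vpMean_nonneg hk (x - y)
  have hle := vpMean_sub_le hk x y
  rw [vpMean_smul _ _ zero_le_two, vpMean_smul _ _ zero_le_two]
  rcases le_total (vpMean lam x (k + 1)) (vpMean lam y (k + 1)) with h | h
  · exact le_add_left (ENNReal.ofReal_le_ofReal (Real.rpow_le_rpow hd (by linarith) hpk))
  · exact le_add_right (ENNReal.ofReal_le_ofReal (Real.rpow_le_rpow hd (by linarith) hpk))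

lemma memVrho.sub (hlam : ∀ k, 1 ≤ k → 0 < lam k) (hp : ∀ k, 1 ≤ k → 1 < pp k)
    {x y : ℕ → ℝ} (hx : memVrho lam pp x) (hy : memVrho lam pp y) :
    memVrho lam pp (x - y) := by
  obtain ⟨s, hs, hxs⟩ := hx
  obtain ⟨t, ht, hyt⟩ := hy
  have key : ∀ {z : ℕ → ℝ} {r : ℝ}, 0 < r → min s t ≤ r → vpModular lam pp (r • z) < ⊤ →
      vpModular lam pp ((2 : ℝ) • (min s t / 2) • z) < ⊤ := by
    intro z r hr hle hz
    have hmin : 0 < min s t := lt_min hs ht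
    have : (2 : ℝ) • (min s t / 2) • z = (min s t / r) • r • z := by
      rw [smul_smul, smul_smul, div_mul_cancel₀ _ hr.ne', mul_div_cancel₀ _ two_ne_zero]
    rw [this]
    exact (vpModular_smul_le_self hlam hp _ (by positivity)
      ((div_le_one hr).2 hle)).trans_lt hz
  refine ⟨min s t / 2, half_pos (lt_min hs ht), ?_⟩
  rw [smul_sub]
  exact (vpModular_sub_le hlam hp _ _).trans_lt
    (ENNReal.add_lt_top.2 ⟨key hs (min_le_left _ _) hxs, key ht (min_le_right _ _) hyt⟩)

lemma memVrho.exists_vpModular_inv_smul_le_one (hlam : ∀ k, 1 ≤ k → 0 < lam k)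
    (hp : ∀ k, 1 ≤ k → 1 < pp k) {x : ℕ → ℝ} (hx : memVrho lam pp x) :
    {t : ℝ | 0 < t ∧ vpModular lam pp (t⁻¹ • x) ≤ 1}.Nonempty := by
  obtain ⟨t, ht, hxt⟩ := hx
  set M := (vpModular lam pp (t • x)).toReal with hM
  have hM0 : 0 ≤ M := ENNReal.toReal_nonneg
  have hM1 : 0 < M + 1 := by linarith
  refine ⟨(M + 1) / t, by positivity, ?_⟩
  have : ((M + 1) / t)⁻¹ • x = (M + 1)⁻¹ • t • x := by
    rw [smul_smul, inv_div, div_eq_inv_mul]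
  rw [this]
  refine (vpModular_smul_le hlam hp _ (by positivity)
    (inv_le_one_of_one_le₀ (by linarith))).trans ?_
  rw [← ENNReal.ofReal_toReal hxt.ne, ← hM, ← ENNReal.ofReal_mul (by positivity),
    ENNReal.ofReal_le_one, inv_mul_le_one₀ hM1]
  linarith

lemma memVrho.vpModular_inv_smul_le_one_of_luxNorm_lt (hlam : ∀ k, 1 ≤ k → 0 < lam k)
    (hp : ∀ k, 1 ≤ k → 1 < pp k) {x : ℕ → ℝ} (hx : memVrho lam pp x) {ε : ℝ}
    (h : luxNorm lam pp x < ε) : vpModular lam pp (ε⁻¹ • x) ≤ 1 := by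
  obtain ⟨t, ⟨ht, hxt⟩, htε⟩ :=
    exists_lt_of_csInf_lt (hx.exists_vpModular_inv_smul_le_one hlam hp) h
  have hε : 0 < ε := ht.trans htε
  have : ε⁻¹ • x = (t / ε) • t⁻¹ • x := by
    rw [smul_smul, div_mul_eq_mul_div, mul_inv_cancel₀ ht.ne', one_div]
  rw [this]
  exact (vpModular_smul_le_self hlam hp _ (by positivity) ((div_le_one hε).2 htε.le)).trans hxt

lemma luxNorm_nonneg (x : ℕ → ℝ) : 0 ≤ luxNorm lam pp x :=
  Real.sInf_nonneg fun _ ht => ht.1.le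

lemma luxNorm_le_of_vpModular_le_one {x : ℕ → ℝ} {ε : ℝ} (hε : 0 < ε)
    (h : vpModular lam pp (ε⁻¹ • x) ≤ 1) : luxNorm lam pp x ≤ ε :=
  csInf_le ⟨0, fun _ ht => ht.1.le⟩ ⟨hε, h⟩

lemma vpMean_le_one_of_vpModular_le_one (hp : ∀ k, 1 ≤ k → 1 < pp k) {x : ℕ → ℝ}
    (h : vpModular lam pp x ≤ 1) {k : ℕ}
    (hk : 1 ≤ k) : vpMean lam x k ≤ 1 := by
  obtain ⟨k, rfl⟩ := Nat.exists_eq_add_of_le' hk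
  have hterm := (ENNReal.le_tsum k).trans ((vpModular_eq_tsum_vpMean lam pp x).symm.trans_le h)
  rw [ENNReal.ofReal_le_one] at hterm
  by_contra! hlt
  exact (Real.one_lt_rpow hlt (by linarith [hp _ hk])).not_ge hterm

/-- The modular is lower semicontinuous under coordinatewise convergence. -/
lemma vpModular_le_of_tendsto (hp : ∀ k, 1 ≤ k → 1 < pp k)
    {u : ℕ → ℕ → ℝ} {x : ℕ → ℝ} {C : ℝ≥0∞}
    (h : ∀ j, 1 ≤ j → Tendsto (fun m => u m j) atTop (nhds (x j)))
    (hC : ∀ᶠ m in atTop, vpModular lam pp (u m) ≤ C) : vpModular lam pp x ≤ C := by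
  rw [vpModular_eq_tsum_vpMean, ENNReal.tsum_eq_iSup_sum]
  refine iSup_le fun s => ?_
  have hlim : Tendsto
      (fun m => ∑ k ∈ s, ENNReal.ofReal (vpMean lam (u m) (k + 1) ^ pp (k + 1))) atTop
      (nhds (∑ k ∈ s, ENNReal.ofReal (vpMean lam x (k + 1) ^ pp (k + 1)))) :=
    tendsto_finsetSum _ fun k _ => ENNReal.tendsto_ofReal
      ((tendsto_vpMean lam h).rpow_const (Or.inr (by linarith [hp (k + 1) (by omega)])))
  refine le_of_tendsto hlim (hC.mono fun m hm => ?_)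
  exact (ENNReal.sum_le_tsum s).trans hm

end Modular

/-- `V_ρ(λ;p)` is complete with respect to the Luxemburg norm. -/
theorem luxNorm_complete (lam pp : ℕ → ℝ)
    (hlam1 : lam 1 = 1)
    (hlam_pos : ∀ k : ℕ, 1 ≤ k → 0 < lam k)
    (hlam_mono : ∀ k : ℕ, 1 ≤ k → lam k ≤ lam (k + 1))
    (hlam_step : ∀ k : ℕ, 1 ≤ k → lam (k + 1) ≤ lam k + 1)
    (hlam_top : Tendsto lam atTop atTop)
    (hp_gt : ∀ k : ℕ, 1 ≤ k → 1 < pp k)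
    (hp_bdd : BddAbove (Set.range fun k : ℕ => pp (k + 1)))
    (xs : ℕ → ℕ → ℝ) (hxs : ∀ n, memVrho lam pp (xs n))
    (hcauchy : ∀ ε : ℝ, 0 < ε → ∃ N : ℕ, ∀ m n : ℕ, N ≤ m → N ≤ n →
      luxNorm lam pp (xs n - xs m) < ε) :
    ∃ x : ℕ → ℝ, memVrho lam pp x ∧
      Tendsto (fun n => luxNorm lam pp (xs n - x)) atTop (nhds 0) := by
  have hlam_one : ∀ k, 1 ≤ k → 1 ≤ lam k := fun k hk => by
    induction k, hk using Nat.le_induction with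
    | base => exact hlam1.ge
    | succ k hk ih => exact ih.trans (hlam_mono k hk)
  have hmod : ∀ ε : ℝ, 0 < ε → ∃ N : ℕ, ∀ m n : ℕ, N ≤ m → N ≤ n →
      vpModular lam pp (ε⁻¹ • (xs n - xs m)) ≤ 1 := fun ε hε => by
    obtain ⟨N, hN⟩ := hcauchy ε hε
    exact ⟨N, fun m n hm hn => ((hxs n).sub hlam_pos hp_gt
      (hxs m)).vpModular_inv_smul_le_one_of_luxNorm_lt hlam_pos hp_gt (hN m n hm hn)⟩
  have hcoord : ∀ j, 1 ≤ j → ∃ a, Tendsto (fun n => xs n j) atTop (nhds a) := fun j hj => by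
    refine cauchySeq_tendsto_of_complete (Metric.cauchySeq_iff.2 fun ε hε => ?_)
    have hj0 := hlam_pos j hj
    have hδ : 0 < ε / (2 * lam j) := by positivity
    obtain ⟨N, hN⟩ := hmod _ hδ
    refine ⟨N, fun m hm n hn => ?_⟩
    have hmean := vpMean_le_one_of_vpModular_le_one hp_gt (hN n m hn hm) hj
    rw [vpMean_smul _ _ (inv_nonneg.2 hδ.le), inv_mul_le_one₀ hδ] at hmean
    calc dist (xs m j) (xs n j) = |(xs m - xs n) j| := Real.dist_eq _ _
      _ ≤ lam j * vpMean lam (xs m - xs n) j := abs_le_mul_vpMean hj (hlam_one j hj) _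
      _ ≤ lam j * (ε / (2 * lam j)) := mul_le_mul_of_nonneg_left hmean hj0.le
      _ = ε / 2 := by field_simp
      _ < ε := half_lt_self hε
  choose! x hx using hcoord
  have hlimit : ∀ ε : ℝ, 0 < ε → ∃ N : ℕ, ∀ n, N ≤ n →
      vpModular lam pp (ε⁻¹ • (xs n - x)) ≤ 1 := fun ε hε => by
    obtain ⟨N, hN⟩ := hmod ε hε
    refine ⟨N, fun n hn => vpModular_le_of_tendsto hp_gt (u := fun m => ε⁻¹ • (xs n - xs m))
      (fun j hj => ((hx j hj).const_sub (xs n j)).const_mul ε⁻¹) ?_⟩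
    filter_upwards [eventually_ge_atTop N] with m hm using hN m n hm hn
  refine ⟨x, ?_, Metric.tendsto_atTop.2 fun ε hε => ?_⟩
  · obtain ⟨N, hN⟩ := hlimit 1 one_pos
    have hdiff : memVrho lam pp (xs N - x) :=
      ⟨1⁻¹, by norm_num, (hN N le_rfl).trans_lt ENNReal.one_lt_top⟩
    simpa using (hxs N).sub hlam_pos hp_gt hdiff
  · obtain ⟨N, hN⟩ := hlimit (ε / 2) (half_pos hε)
    refine ⟨N, fun n hn => ?_⟩
    rw [Real.dist_0_eq_abs, abs_of_nonneg (luxNorm_nonneg _)]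
    exact (luxNorm_le_of_vpModular_le_one (half_pos hε) (hN n hn)).trans_lt (half_lt_self hε)
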